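/- Let s ∈ (0,1), p ∈ [2,∞), N ≥ 2 an integer with sp < N, and let f : ℝ → ℝ be continuous with f(t) = 0 for t ≤ 0, satisfying (f1), (f2), (f3)_gs and (f5). Then D > 0, where D = inf{ (1/p)[u]_{s,p}^p : u ∈ M } and M = { u ∈ W^{s,p}(ℝ^N), u ≠ 0 : ∫_{ℝ^N} G(u) dx = 1 }. -/

import Mathlib

open MeasureTheory Real Filter Topology Set

noncomputable section

/-- `ℝ^N` -/
abbrev RN (N : ℕ) := EuclideanSpace ℝ (Fin N)

/-- The `p`-th power of the Gagliardo seminorm `[u]_{s,p}`, as an extended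
nonnegative real number:
`[u]_{s,p}^p = ∫∫ |u x - u y|^p / |x-y|^(N+sp) dx dy`. -/
def gagE (N : ℕ) (s p : ℝ) (u : RN N → ℝ) : ENNReal :=
  ∫⁻ x : RN N, ∫⁻ y : RN N,
    ENNReal.ofReal (|u x - u y| ^ p / ‖x - y‖ ^ ((N : ℝ) + s * p))

/-- The `p`-th power of the Gagliardo seminorm, as a real number. -/
def gagP (N : ℕ) (s p : ℝ) (u : RN N → ℝ) : ℝ := (gagE N s p u).toReal

/-- Membership in the fractional Sobolev space `W^{s,p}(ℝ^N)`:
`u ∈ L^p(ℝ^N)` and `[u]_{s,p} < ∞`. -/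
def memW (N : ℕ) (s p : ℝ) (u : RN N → ℝ) : Prop :=
  AEStronglyMeasurable u volume ∧ Integrable (fun x => |u x| ^ p) volume ∧
    gagE N s p u < ⊤

/-- `‖u‖_{s,p}^p = [u]_{s,p}^p + ‖u‖_{L^p}^p`. -/
def sobNormP (N : ℕ) (s p : ℝ) (u : RN N → ℝ) : ℝ :=
  gagP N s p u + ∫ x : RN N, |u x| ^ p

/-- The norm `‖u‖_{s,p} = ([u]_{s,p}^p + ‖u‖_{L^p}^p)^(1/p)`. -/
def sobNorm (N : ℕ) (s p : ℝ) (u : RN N → ℝ) : ℝ := (sobNormP N s p u) ^ (1 / p)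

/-- `u` is radially symmetric: `u x` depends only on `‖x‖`. -/
def radial (N : ℕ) (u : RN N → ℝ) : Prop := ∀ x y : RN N, ‖x‖ = ‖y‖ → u x = u y

/-- Membership in `W_r^{s,p}(ℝ^N)`, the subspace of radial functions. -/
def memWr (N : ℕ) (s p : ℝ) (u : RN N → ℝ) : Prop := memW N s p u ∧ radial N u

/-- The primitive `F(t) = ∫_0^t f(τ) dτ`. -/
def primF (f : ℝ → ℝ) (t : ℝ) : ℝ := ∫ τ in (0:ℝ)..t, f τ

/-- The energy functional `I(u) = (1/p)‖u‖_{s,p}^p - ∫ F(u)`. -/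
def ene (N : ℕ) (s p : ℝ) (f : ℝ → ℝ) (u : RN N → ℝ) : ℝ :=
  (1 / p) * sobNormP N s p u - ∫ x : RN N, primF f (u x)

/-- The pairing `⟨(-Δ_p)^s u, φ⟩`. -/
def pairA (N : ℕ) (s p : ℝ) (u φ : RN N → ℝ) : ℝ :=
  ∫ x : RN N, ∫ y : RN N,
    |u x - u y| ^ (p - 2) * (u x - u y) * (φ x - φ y) / ‖x - y‖ ^ ((N : ℝ) + s * p)

/-- The derivative `I'(u)·φ`. -/
def enePrime (N : ℕ) (s p : ℝ) (f : ℝ → ℝ) (u φ : RN N → ℝ) : ℝ :=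
  pairA N s p u φ + (∫ x : RN N, |u x| ^ (p - 2) * u x * φ x) -
    ∫ x : RN N, f (u x) * φ x

/-- `u` is a weak solution of `(-Δ_p)^s u = -|u|^{p-2}u + f(u)` in `ℝ^N`:
for every `φ ∈ W^{s,p}(ℝ^N)`,
`⟨(-Δ_p)^s u, φ⟩ + ∫ |u|^{p-2} u φ = ∫ f(u) φ`. -/
def weakSol (N : ℕ) (s p : ℝ) (f : ℝ → ℝ) (u : RN N → ℝ) : Prop :=
  ∀ φ : RN N → ℝ, memW N s p φ →
    pairA N s p u φ + (∫ x : RN N, |u x| ^ (p - 2) * u x * φ x) =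
      ∫ x : RN N, f (u x) * φ x

/-- Hypothesis (f1): `lim_{t→0} f(t)/(|t|^{p-2} t) = 0`. -/
def hypF1 (p : ℝ) (f : ℝ → ℝ) : Prop :=
  Tendsto (fun t => f t / (|t| ^ (p - 2) * t)) (𝓝[≠] (0:ℝ)) (𝓝 0)

/-- Hypothesis (f2): `limsup_{t→+∞} f(t)/t^{p_s^*-1} ≤ 1`, where
`p_s^* = pN/(N-sp)`. -/
def hypF2 (N : ℕ) (s p : ℝ) (f : ℝ → ℝ) : Prop :=
  Filter.limsup (fun t : ℝ => ((f t / t ^ (p * N / ((N : ℝ) - s * p) - 1) : ℝ) : EReal))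
    atTop ≤ 1

/-- Hypothesis (f3): there are `μ > 0` and `q ∈ (p,∞)` with `f(t) ≥ μ t^{q-1}`
for all `t ≥ 0`. -/
def hypF3 (p : ℝ) (f : ℝ → ℝ) : Prop :=
  ∃ μ > (0:ℝ), ∃ q : ℝ, p < q ∧ ∀ t ≥ (0:ℝ), μ * t ^ (q - 1) ≤ f t

/-- Hypothesis (f4) with threshold `α₀`:
`lim_{t→+∞} f(t)/e^{α t^{N/(N-s)}} = 0` for `α > α₀` and `= +∞` for `0 < α < α₀`. -/
def hypF4 (N : ℕ) (s : ℝ) (f : ℝ → ℝ) (α₀ : ℝ) : Prop :=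
  (∀ α > α₀, Tendsto (fun t => f t / Real.exp (α * t ^ ((N : ℝ) / ((N : ℝ) - s))))
      atTop (𝓝 0)) ∧
  (∀ α : ℝ, 0 < α → α < α₀ →
    Tendsto (fun t => f t / Real.exp (α * t ^ ((N : ℝ) / ((N : ℝ) - s)))) atTop atTop)

/-- `Q_α(t) = e^{α|t|^{p'}} - ∑_{0 ≤ j < p} (α|t|^{p'})^j / j!`, with `p' = p/(p-1)`. -/
def Qfun (p α t : ℝ) : ℝ :=
  Real.exp (α * |t| ^ (p / (p - 1))) -
    ∑ j ∈ Finset.range ⌈p⌉₊, (α * |t| ^ (p / (p - 1))) ^ j / (Nat.factorial j : ℝ)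

/-- `G(t) = F(t) - |t|^p/p`, the primitive of `g(t) = -|t|^{p-2}t + f(t)`. -/
def Gfun (p : ℝ) (f : ℝ → ℝ) (t : ℝ) : ℝ := primF f t - |t| ^ p / p

/-- The best constant `C_q` of the embedding `W^{s,p}(ℝ^N) ↪ L^q(ℝ^N)`:
`C_q = inf { ([u]_{s,p}^p + ‖u‖_{L^p}^p) / ‖u‖_{L^q}^p : u ≠ 0 }`. -/
def CqConst (N : ℕ) (s p q : ℝ) : ℝ :=
  sInf {r : ℝ | ∃ u : RN N → ℝ, memW N s p u ∧ u ≠ 0 ∧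
    r = sobNormP N s p u / (∫ x : RN N, |u x| ^ q) ^ (p / q)}

/-- The best fractional Sobolev constant
`S = inf { [u]_{s,p}^p / ‖u‖_{L^{p_s^*}}^p : u ∈ D^{s,p}(ℝ^N), u ≠ 0 }`. -/
def Sconst (N : ℕ) (s p : ℝ) : ℝ :=
  sInf {r : ℝ | ∃ u : RN N → ℝ,
    Integrable (fun x => |u x| ^ (p * N / ((N : ℝ) - s * p))) volume ∧
    AEStronglyMeasurable u volume ∧ gagE N s p u < ⊤ ∧ u ≠ 0 ∧
    r = gagP N s p u /
      (∫ x : RN N, |u x| ^ (p * N / ((N : ℝ) - s * p))) ^ (p / (p * N / ((N : ℝ) - s * p)))}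

/-- The constant `μ*` in hypothesis `(f3)_gs` when `sp < N`. -/
def muStarSub (N : ℕ) (s p q : ℝ) : ℝ :=
  ((p : ℝ) ^ ((s * p - N) / (s * p)) * Sconst N s p ^ (-(N : ℝ) / (s * p)) *
      ((N : ℝ) / s) *
      (p * N / ((N : ℝ) - s * p)) ^ (((N : ℝ) - s * p) / (s * p))) ^ ((q - p) / p) *
    ((q - p) / (p * q)) ^ ((q - p) / p) * CqConst N s p q ^ (q / p)

/-- The constant `μ*` in hypothesis `(f3)_gs` when `sp = N`. -/
def muStarEq (N : ℕ) (s p q : ℝ) : ℝ :=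
  ((q - p) / (p * q)) ^ ((q - p) / p) * CqConst N s p q ^ (q / p)

/-- Hypothesis (f5): `f(t)t - pF(t) ≥ 0` for `t > 0`, and `F ≥ 0`. -/
def hypF5 (p : ℝ) (f : ℝ → ℝ) : Prop :=
  (∀ t > (0:ℝ), 0 ≤ f t * t - p * primF f t) ∧ ∀ t : ℝ, 0 ≤ primF f t

/-- The ground state level `m = inf { I(v) : v ∈ W^{s,p}(ℝ^N) \ {0}, I'(v) = 0 }`. -/
def gsLevel (N : ℕ) (s p : ℝ) (f : ℝ → ℝ) : ℝ :=
  sInf {c : ℝ | ∃ v : RN N → ℝ, memW N s p v ∧ v ≠ 0 ∧ weakSol N s p f v ∧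
    c = ene N s p f v}

/-- Continuity of a path `γ : [0,1] → W^{s,p}(ℝ^N)` with respect to `‖·‖_{s,p}`. -/
def pathCont (N : ℕ) (s p : ℝ) (γ : ℝ → RN N → ℝ) : Prop :=
  ∀ t ∈ Set.Icc (0:ℝ) 1, ∀ ε > (0:ℝ), ∃ δ > (0:ℝ), ∀ t' ∈ Set.Icc (0:ℝ) 1,
    |t - t'| < δ → sobNorm N s p (fun x => γ t x - γ t' x) < ε

/-- The mountain pass level `b = inf_{γ ∈ Γ} max_{t ∈ [0,1]} I(γ(t))`, where
`Γ = { γ : [0,1] → W^{s,p}(ℝ^N) continuous : γ(0) = 0, I(γ(1)) < 0 }`. -/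
def mpLevel (N : ℕ) (s p : ℝ) (f : ℝ → ℝ) : ℝ :=
  sInf {c : ℝ | ∃ γ : ℝ → RN N → ℝ, (∀ t ∈ Set.Icc (0:ℝ) 1, memW N s p (γ t)) ∧
    pathCont N s p γ ∧ γ 0 = 0 ∧ ene N s p f (γ 1) < 0 ∧
    c = sSup ((fun t => ene N s p f (γ t)) '' Set.Icc (0:ℝ) 1)}

/-- The Pohožaev set
`P = { u ∈ W^{s,p}(ℝ^N) \ {0} : ((N-sp)/p)[u]_{s,p}^p = N ∫ G(u) }`. -/
def pohSet (N : ℕ) (s p : ℝ) (f : ℝ → ℝ) : Set (RN N → ℝ) :=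
  {u | memW N s p u ∧ u ≠ 0 ∧
    (((N : ℝ) - s * p) / p) * gagP N s p u = N * ∫ x : RN N, Gfun p f (u x)}

/-- `p̃ = inf { I(u) : u ∈ P }`. -/
def pohLevel (N : ℕ) (s p : ℝ) (f : ℝ → ℝ) : ℝ :=
  sInf {c : ℝ | ∃ u ∈ pohSet N s p f, c = ene N s p f u}

/-- The constraint set `M = { u ∈ W^{s,p}(ℝ^N) \ {0} : ∫ G(u) = 1 }`. -/
def Mset (N : ℕ) (s p : ℝ) (f : ℝ → ℝ) : Set (RN N → ℝ) :=
  {u | memW N s p u ∧ u ≠ 0 ∧ (∫ x : RN N, Gfun p f (u x)) = 1}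

/-- `D = inf { (1/p)[u]_{s,p}^p : u ∈ M }`. -/
def Dconst (N : ℕ) (s p : ℝ) (f : ℝ → ℝ) : ℝ :=
  sInf {c : ℝ | ∃ u ∈ Mset N s p f, c = (1 / p) * gagP N s p u}

/-- `J'(u)·φ = ∫ (f(u) - |u|^{p-2}u) φ`. -/
def Jprime (N : ℕ) (s p : ℝ) (f : ℝ → ℝ) (u φ : RN N → ℝ) : ℝ :=
  ∫ x : RN N, (f (u x) - |u x| ^ (p - 2) * u x) * φ x

/-- `(u_j)` is a `(PS)_c` sequence in `W_r^{s,p}(ℝ^N)` for `I`: `I(u_j) → c` and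
`sup { |I'(u_j)·φ| : φ ∈ W_r^{s,p}, ‖φ‖_{s,p} ≤ 1 } → 0`. -/
def PSseq (N : ℕ) (s p : ℝ) (f : ℝ → ℝ) (c : ℝ) (u : ℕ → RN N → ℝ) : Prop :=
  (∀ j, memWr N s p (u j)) ∧
  Tendsto (fun j => ene N s p f (u j)) atTop (𝓝 c) ∧
  (∀ δ > (0:ℝ), ∀ᶠ j in atTop, ∀ φ : RN N → ℝ, memWr N s p φ →
    sobNorm N s p φ ≤ 1 → |enePrime N s p f (u j) φ| ≤ δ)


/-- the volume of the unit ball -/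
def omegaN (N : ℕ) : ℝ := (volume (Metric.ball (0 : RN N) 1)).toReal

lemma omegaN_pos (N : ℕ) : 0 < omegaN N :=
  ENNReal.toReal_pos (Metric.measure_ball_pos volume _ one_pos).ne' measure_ball_lt_top.ne

lemma volume_ball_RN (N : ℕ) (hN : 2 ≤ N) (x : RN N) (r : ℝ) (hr : 0 ≤ r) :
    volume (Metric.ball x r) = ENNReal.ofReal (r ^ N * omegaN N) := by
  have : Nonempty (Fin N) := ⟨⟨0, by omega⟩⟩
  have : Nontrivial (RN N) := inferInstance
  rw [Measure.addHaar_ball volume x hr, finrank_euclideanSpace_fin,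
    ENNReal.ofReal_mul (by positivity), omegaN, ENNReal.ofReal_toReal measure_ball_lt_top.ne]

lemma gagE_congr (N : ℕ) (s p : ℝ) (u w : RN N → ℝ) (h : u =ᵐ[volume] w) :
    gagE N s p u = gagE N s p w := by
  unfold gagE
  apply lintegral_congr_ae
  filter_upwards [h] with x hx
  apply lintegral_congr_ae
  filter_upwards [h] with y hy
  rw [hx, hy]

lemma gagE_mono (N : ℕ) (s p : ℝ) (hp : 0 ≤ p) (u w : RN N → ℝ)
    (h : ∀ x y, |u x - u y| ≤ |w x - w y|) :
    gagE N s p u ≤ gagE N s p w := by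
  unfold gagE
  refine lintegral_mono fun x => lintegral_mono fun y => ENNReal.ofReal_le_ofReal ?_
  have := h x y
  gcongr

lemma inner_lower (N : ℕ) (s p q : ℝ) (hN : 2 ≤ N) (hs : 0 < s) (hp : 0 < p) (hq : 0 < q)
    (hpq : p + q * (s * p / N) = q)
    (v : RN N → ℝ) (hv : Measurable v) (hv0 : ∀ x, 0 ≤ v x)
    (hint : Integrable (fun x => v x ^ q) volume) (A : ℝ) (hA : A = ∫ x, v x ^ q) (hA0 : 0 < A)
    (x : RN N) (hx : 0 < v x) :
    ENNReal.ofReal (omegaN N / 2 * 2 ^ (-p) * (2 ^ (1 + q) / omegaN N) ^ (-(s * p / N)) *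
      A ^ (-(s * p / N)) * v x ^ q) ≤
    ∫⁻ y : RN N, ENNReal.ofReal (|v x - v y| ^ p / ‖x - y‖ ^ ((N : ℝ) + s * p)) := by
  have hω := omegaN_pos N
  set ω := omegaN N with hωdef
  set t := v x with ht
  have hNpos : (0:ℝ) < N := by positivity
  set α := s * p / N with hα
  set R : ℝ := 2 ^ (1 + q) / ω * A * t ^ (-q) with hR
  have hRpos : 0 < R := by positivity
  set r : ℝ := R ^ ((N:ℝ)⁻¹) with hr
  have hrpos : 0 < r := by positivity
  have hrN : r ^ N = R := Real.rpow_inv_natCast_pow hRpos.le (by omega)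
  have hrNs : r ^ ((N:ℝ) + s * p) = R * R ^ α := by
    rw [hr, ← Real.rpow_mul hRpos.le]
    have : (N:ℝ)⁻¹ * (N + s * p) = 1 + α := by rw [hα]; field_simp
    rw [this, Real.rpow_add hRpos, Real.rpow_one]
  have htq : 0 < (t / 2) ^ q := by positivity
  have hAR : A / (t / 2) ^ q = R * ω / 2 := by
    rw [hR, Real.div_rpow hx.le (by norm_num), Real.rpow_neg hx.le,
      Real.rpow_add (by norm_num), Real.rpow_one]
    field_simp
  set T : Set (RN N) := {y | (t / 2) ^ q ≤ v y ^ q} with hT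
  have hTm : MeasurableSet T := measurableSet_le measurable_const (hv.pow_const q)
  have hTfin : volume T ≠ ⊤ := by
    exact (hint.measure_ge_lt_top htq).ne
  have hTle : volume T ≤ ENNReal.ofReal (R * ω / 2) := by
    have h := mul_meas_ge_le_integral_of_nonneg
      (Eventually.of_forall fun y => Real.rpow_nonneg (hv0 y) q) hint ((t / 2) ^ q)
    rw [← hA] at h
    rw [← ENNReal.ofReal_toReal hTfin]
    apply ENNReal.ofReal_le_ofReal
    rw [← hAR, le_div_iff₀ htq, mul_comm]
    exact h
  set S := Metric.ball x r \ T with hS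
  have hSm : MeasurableSet S := Metric.isOpen_ball.measurableSet.diff hTm
  have hSvol : ENNReal.ofReal (R * ω / 2) ≤ volume S := by
    calc ENNReal.ofReal (R * ω / 2) = ENNReal.ofReal (R * ω) - ENNReal.ofReal (R * ω / 2) := by
          rw [← ENNReal.ofReal_sub _ (by positivity)]; congr 1; ring
      _ ≤ volume (Metric.ball x r) - volume T := by
          rw [volume_ball_RN N hN x r hrpos.le, hrN]
          exact tsub_le_tsub_left hTle _
      _ ≤ volume S := le_measure_sdiff
  have hlow : ∀ y ∈ S, ENNReal.ofReal ((t / 2) ^ p / (R * R ^ α)) ≤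
      ENNReal.ofReal (|t - v y| ^ p / ‖x - y‖ ^ ((N : ℝ) + s * p)) := by
    intro y hy
    apply ENNReal.ofReal_le_ofReal
    have hyT : v y < t / 2 := by
      have h2 : ¬ ((t / 2) ^ q ≤ v y ^ q) := hy.2
      by_contra hcon
      push Not at hcon
      exact h2 (Real.rpow_le_rpow (by positivity) hcon hq.le)
    have hne : x ≠ y := by
      rintro rfl
      rw [← ht] at hyT
      linarith
    have hnpos : 0 < ‖x - y‖ := norm_pos_iff.2 (sub_ne_zero.2 hne)
    have hlt : ‖x - y‖ ≤ r := by
      have := hy.1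
      rw [Metric.mem_ball, dist_comm, dist_eq_norm] at this
      exact this.le
    rw [← hrNs]
    have h1 : t / 2 ≤ |t - v y| := by
      rw [abs_of_pos (by linarith)]; linarith
    gcongr
  calc _ = ENNReal.ofReal ((t / 2) ^ p / (R * R ^ α)) * ENNReal.ofReal (R * ω / 2) := by
        rw [← ENNReal.ofReal_mul (by positivity)]
        congr 1
        have e1 : R ^ α = (2 ^ (1 + q) / ω) ^ α * A ^ α * t ^ (-(q * α)) := by
          rw [hR, Real.mul_rpow (by positivity) (by positivity),
            Real.mul_rpow (by positivity) (by positivity), ← Real.rpow_mul hx.le]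
          congr 2; ring
        have e2 : t ^ q = t ^ p * t ^ (q * α) := by
          rw [← Real.rpow_add hx, hpq]
        rw [e1, e2, Real.div_rpow hx.le (by norm_num), Real.rpow_neg (by norm_num),
          Real.rpow_neg (by positivity), Real.rpow_neg hA0.le, Real.rpow_neg hx.le]
        field_simp
    _ ≤ ENNReal.ofReal ((t / 2) ^ p / (R * R ^ α)) * volume S := by gcongr
    _ = ∫⁻ y in S, ENNReal.ofReal ((t / 2) ^ p / (R * R ^ α)) := by rw [setLIntegral_const]
    _ ≤ ∫⁻ y in S, ENNReal.ofReal (|t - v y| ^ p / ‖x - y‖ ^ ((N : ℝ) + s * p)) :=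
        setLIntegral_mono' hSm hlow
    _ ≤ _ := setLIntegral_le_lintegral _ _

lemma sobolev_core (N : ℕ) (s p q : ℝ) (hN : 2 ≤ N) (hs : 0 < s) (hp : 0 < p) (hq : 0 < q)
    (hsp : s * p < N)
    (hpq : p + q * (s * p / N) = q) :
    ∃ K > (0:ℝ), ∀ v : RN N → ℝ, Measurable v → (∀ x, 0 ≤ v x) →
      Integrable (fun x => v x ^ q) volume → gagE N s p v < ⊤ →
      (∫ x, v x ^ q) ^ (1 - s * p / N) ≤ K * gagP N s p v := by
  have hω := omegaN_pos N
  have hNpos : (0:ℝ) < N := by positivity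
  set c : ℝ := omegaN N / 2 * 2 ^ (-p) * (2 ^ (1 + q) / omegaN N) ^ (-(s * p / N)) with hc
  have hcpos : 0 < c := by positivity
  refine ⟨c⁻¹, by positivity, ?_⟩
  intro v hv hv0 hint hfin
  have hα : 0 < 1 - s * p / N := by
    have : s * p / N < 1 := by rw [div_lt_one hNpos]; exact hsp
    linarith
  set A := ∫ x, v x ^ q with hA
  have hA0 : 0 ≤ A := integral_nonneg fun x => Real.rpow_nonneg (hv0 x) q
  have hg0 : 0 ≤ gagP N s p v := ENNReal.toReal_nonneg
  rcases hA0.eq_or_lt with h | hApos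
  · rw [← h, Real.zero_rpow hα.ne']; positivity
  have key : ENNReal.ofReal (c * A ^ (-(s * p / N)) * A) ≤ gagE N s p v := by
    have e : ENNReal.ofReal (c * A ^ (-(s * p / N)) * A) =
        ∫⁻ x, ENNReal.ofReal (c * A ^ (-(s * p / N)) * v x ^ q) := by
      rw [← ofReal_integral_eq_lintegral_ofReal, integral_const_mul]
      · exact hint.const_mul _
      · exact Eventually.of_forall fun x => mul_nonneg (by positivity) (Real.rpow_nonneg (hv0 x) q)
    rw [e]
    apply lintegral_mono
    intro x
    rcases (hv0 x).eq_or_lt with h0 | hpos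
    · simp only [← h0, Real.zero_rpow hq.ne', mul_zero, ENNReal.ofReal_zero]; exact zero_le
    · exact inner_lower N s p q hN hs hp hq hpq v hv hv0 hint A hA hApos x hpos
  have h2 : c * A ^ (-(s * p / N)) * A ≤ gagP N s p v :=
    (ENNReal.ofReal_le_iff_le_toReal hfin.ne).1 key
  have h3 : A ^ (1 - s * p / N) = A ^ (-(s * p / N)) * A := by
    rw [sub_eq_neg_add, Real.rpow_add hApos, Real.rpow_one]
  rw [h3, inv_mul_eq_div, le_div_iff₀ hcpos]
  linarith

lemma sobolev_ineq (N : ℕ) (s p q : ℝ) (hN : 2 ≤ N) (hs : 0 < s) (hp : 0 < p) (hq : p < q)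
    (hsp : s * p < N)
    (hpq : p + q * (s * p / N) = q) :
    ∃ K > (0:ℝ), ∀ u : RN N → ℝ, memW N s p u →
      Integrable (fun x => |u x| ^ q) volume ∧
      (∫ x, |u x| ^ q) ^ (1 - s * p / N) ≤ K * gagP N s p u := by
  obtain ⟨K, hK, hcore⟩ := sobolev_core N s p q hN hs hp (hp.trans hq) hsp hpq
  refine ⟨K, hK, ?_⟩
  intro u ⟨hum, hup, hug⟩
  have hq0 : 0 < q := hp.trans hq
  have hNpos : (0:ℝ) < N := by positivity
  have hα : 0 < 1 - s * p / N := by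
    have : s * p / N < 1 := by rw [div_lt_one hNpos]; exact hsp
    linarith
  set w := hum.mk u with hw
  have hwm : Measurable w := hum.stronglyMeasurable_mk.measurable
  have huw : u =ᵐ[volume] w := hum.ae_eq_mk
  have hgE : gagE N s p u = gagE N s p w := gagE_congr N s p u w huw
  have hwp : Integrable (fun x => |w x| ^ p) volume :=
    hup.congr (by filter_upwards [huw] with x hx; rw [hx])
  set v : ℕ → RN N → ℝ := fun k x => min |w x| k with hvdef
  have hv0 : ∀ k x, 0 ≤ v k x := fun k x => le_min (abs_nonneg _) (Nat.cast_nonneg k)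
  have hvm : ∀ k, Measurable (v k) := fun k => (hwm.abs).min measurable_const
  have hg0 : 0 ≤ gagP N s p u := ENNReal.toReal_nonneg
  have hvint : ∀ k, Integrable (fun x => v k x ^ q) volume := by
    intro k
    refine (hwp.const_mul ((k:ℝ) ^ (q - p))).mono' ((hvm k).pow_const q).aestronglyMeasurable
      (Eventually.of_forall fun x => ?_)
    rw [Real.norm_of_nonneg (Real.rpow_nonneg (hv0 k x) q)]
    have : v k x ^ q = v k x ^ (q - p) * v k x ^ p := by
      rw [← Real.rpow_add_of_nonneg (hv0 k x) (by linarith) hp.le]; congr 1; ring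
    rw [this]
    have h1 : v k x ≤ k := min_le_right _ _
    have h2 : v k x ≤ |w x| := min_le_left _ _
    have := hv0 k x
    have : 0 ≤ q - p := by linarith
    gcongr
  have hvg : ∀ k, gagE N s p (v k) ≤ gagE N s p u := by
    intro k
    rw [hgE]
    apply gagE_mono N s p hp.le
    intro x y
    calc |v k x - v k y| ≤ max (abs (abs (w x) - abs (w y))) (abs ((k:ℝ) - k)) := abs_min_sub_min_le_max _ _ _ _
      _ ≤ |w x - w y| := by
        simp only [sub_self, abs_zero]
        exact max_le (abs_abs_sub_abs_le_abs_sub _ _) (abs_nonneg _)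
  set B := (K * gagP N s p u) ^ (1 - s * p / N)⁻¹ with hB
  have hB0 : 0 ≤ B := by positivity
  have hvB : ∀ k, ∫ x, v k x ^ q ≤ B := by
    intro k
    have h1 := hcore (v k) (hvm k) (hv0 k) (hvint k) ((hvg k).trans_lt hug)
    have h2 : gagP N s p (v k) ≤ gagP N s p u := ENNReal.toReal_mono hug.ne (hvg k)
    rw [hB, Real.le_rpow_inv_iff_of_pos (integral_nonneg fun x => Real.rpow_nonneg (hv0 k x) q)
      (by positivity) hα]
    exact h1.trans (by gcongr)
  have hlim : ∫⁻ x, ENNReal.ofReal (|w x| ^ q) ≤ ENNReal.ofReal B := by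
    calc ∫⁻ x, ENNReal.ofReal (|w x| ^ q)
        = ∫⁻ x, liminf (fun k => ENNReal.ofReal (v k x ^ q)) atTop := by
          apply lintegral_congr
          intro x
          symm
          apply Tendsto.liminf_eq
          apply tendsto_const_nhds.congr'
          filter_upwards [eventually_ge_atTop ⌈|w x|⌉₊] with k hk
          have : |w x| ≤ k := Nat.ceil_le.1 hk
          simp only [hvdef, min_eq_left this]
      _ ≤ liminf (fun k => ∫⁻ x, ENNReal.ofReal (v k x ^ q)) atTop :=
          lintegral_liminf_le fun k => ((hvm k).pow_const q).ennreal_ofReal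
      _ ≤ liminf (fun _ : ℕ => ENNReal.ofReal B) atTop := by
          refine liminf_le_liminf (Eventually.of_forall fun k => ?_)
          rw [← ofReal_integral_eq_lintegral_ofReal (hvint k)
            (Eventually.of_forall fun x => Real.rpow_nonneg (hv0 k x) q)]
          exact ENNReal.ofReal_le_ofReal (hvB k)
      _ = ENNReal.ofReal B := by simp
  have hwint : Integrable (fun x => |w x| ^ q) volume := by
    refine ⟨(hwm.abs.pow_const q).aestronglyMeasurable, ?_⟩
    rw [hasFiniteIntegral_iff_ofReal (Eventually.of_forall fun x => by positivity)]
    exact hlim.trans_lt ENNReal.ofReal_lt_top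
  have hcongr : (fun x => |w x| ^ q) =ᵐ[volume] (fun x => |u x| ^ q) := by
    filter_upwards [huw] with x hx; rw [hx]
  refine ⟨hwint.congr hcongr, ?_⟩
  rw [← integral_congr_ae hcongr]
  rw [← Real.le_rpow_inv_iff_of_pos (integral_nonneg fun x => by positivity)
      (by positivity) hα, ← hB]
  rw [← ofReal_integral_eq_lintegral_ofReal hwint
            (Eventually.of_forall fun x => by positivity)] at hlim
  exact (ENNReal.ofReal_le_ofReal_iff hB0).1 hlim

lemma kernel_integrable (N : ℕ) (s p L C : ℝ) (hN : 2 ≤ N) (hs : 0 < s) (hs1 : s < 1) (hp : 2 ≤ p)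
    (hL : 0 ≤ L) (hC : 0 ≤ C) :
    Integrable (fun z : RN N => min (L * ‖z‖) C ^ p / ‖z‖ ^ ((N : ℝ) + s * p)) volume := by
  have : Nonempty (Fin N) := ⟨⟨0, by omega⟩⟩
  have : Nontrivial (RN N) := inferInstance
  have hp0 : 0 < p := by linarith
  have key := integrable_fun_norm_addHaar (volume : Measure (RN N))
    (f := fun ρ : ℝ => min (L * ρ) C ^ p / ρ ^ ((N : ℝ) + s * p))
  refine key.2 ?_
  rw [finrank_euclideanSpace_fin]
  have hmeas : Measurable (fun y : ℝ => y ^ (N - 1) • (min (L * y) C ^ p / y ^ ((N : ℝ) + s * p))) := by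
    simp only [smul_eq_mul]
    fun_prop
  rw [← Ioc_union_Ioi_eq_Ioi (zero_le_one (α := ℝ))]
  have hpow : ∀ y : ℝ, 0 < y → y ^ (N - 1) = y ^ ((N : ℝ) - 1) := by
    intro y hy
    rw [← Real.rpow_natCast, Nat.cast_sub (by omega), Nat.cast_one]
  refine IntegrableOn.union ?_ ?_
  · have h1 : IntegrableOn (fun y : ℝ => L ^ p * y ^ (p - s * p - 1)) (Ioc 0 1) volume := by
      have := intervalIntegral.intervalIntegrable_rpow' (a := 0) (b := 1)
        (r := p - s * p - 1) (by nlinarith)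
      rw [intervalIntegrable_iff_integrableOn_Ioc_of_le zero_le_one] at this
      exact this.const_mul _
    refine Integrable.mono' h1 hmeas.aestronglyMeasurable ?_
    refine (ae_restrict_mem measurableSet_Ioc).mono fun y hy => ?_
    have hy0 : 0 < y := hy.1
    have hm0 : 0 ≤ min (L * y) C := le_min (by positivity) hC
    rw [smul_eq_mul, Real.norm_of_nonneg (by positivity), hpow y hy0]
    have h2 : min (L * y) C ^ p ≤ L ^ p * y ^ p := by
      rw [← Real.mul_rpow hL hy0.le]
      exact Real.rpow_le_rpow hm0 (min_le_left _ _) hp0.le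
    calc y ^ ((N:ℝ) - 1) * (min (L * y) C ^ p / y ^ ((N : ℝ) + s * p))
        ≤ y ^ ((N:ℝ) - 1) * (L ^ p * y ^ p / y ^ ((N : ℝ) + s * p)) := by gcongr
      _ = L ^ p * (y ^ ((N:ℝ) - 1) * y ^ p / y ^ ((N : ℝ) + s * p)) := by ring
      _ = L ^ p * y ^ (p - s * p - 1) := by
        rw [← Real.rpow_add hy0, ← Real.rpow_sub hy0]; congr 2; ring
  · have h1 : IntegrableOn (fun y : ℝ => C ^ p * y ^ (- (s * p) - 1)) (Ioi 1) volume :=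
      (integrableOn_Ioi_rpow_of_lt (by nlinarith) one_pos).const_mul _
    refine Integrable.mono' h1 hmeas.aestronglyMeasurable ?_
    refine (ae_restrict_mem measurableSet_Ioi).mono fun y hy => ?_
    have hy0 : 0 < y := one_pos.trans hy
    have hm0 : 0 ≤ min (L * y) C := le_min (by positivity) hC
    rw [smul_eq_mul, Real.norm_of_nonneg (by positivity), hpow y hy0]
    have h2 : min (L * y) C ^ p ≤ C ^ p :=
      Real.rpow_le_rpow hm0 (min_le_right _ _) hp0.le
    calc y ^ ((N:ℝ) - 1) * (min (L * y) C ^ p / y ^ ((N : ℝ) + s * p))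
        ≤ y ^ ((N:ℝ) - 1) * (C ^ p / y ^ ((N : ℝ) + s * p)) := by gcongr
      _ = C ^ p * (y ^ ((N:ℝ) - 1) / y ^ ((N : ℝ) + s * p)) := by ring
      _ = C ^ p * y ^ (- (s * p) - 1) := by
        rw [← Real.rpow_sub hy0]; congr 2; ring

lemma memW_of_lip (N : ℕ) (s p L C : ℝ) (hN : 2 ≤ N) (hs : 0 < s) (hs1 : s < 1) (hp : 2 ≤ p)
    (hL : 0 ≤ L) (hC : 0 ≤ C) (u : RN N → ℝ) (hu : Continuous u)
    (hlip : ∀ x y, |u x - u y| ≤ L * ‖x - y‖) (hbd : ∀ x y, |u x - u y| ≤ C)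
    (hcs : HasCompactSupport u) : memW N s p u := by
  have hp0 : 0 < p := by linarith
  refine ⟨hu.aestronglyMeasurable, ?_, ?_⟩
  · apply Continuous.integrable_of_hasCompactSupport
    · exact hu.abs.rpow_const fun x => Or.inr hp0.le
    · exact hcs.comp_left (g := fun t : ℝ => |t| ^ p) (by simp [hp0.ne'])
  · set h : RN N → ENNReal := fun z =>
      ENNReal.ofReal (min (L * ‖z‖) C ^ p / ‖z‖ ^ ((N : ℝ) + s * p)) with hh
    have hhm : Measurable h := by
      rw [hh]; fun_prop
    have hJ : ∫⁻ z, h z < ⊤ := by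
      have := kernel_integrable N s p L C hN hs hs1 hp hL hC
      exact (hasFiniteIntegral_iff_ofReal (Eventually.of_forall fun z => by
        have : 0 ≤ min (L * ‖z‖) C := le_min (by positivity) hC
        simp only [Pi.zero_apply]
        positivity)).1 this.2
    set T := tsupport u with hT
    have hTm : MeasurableSet T := (isClosed_tsupport u).measurableSet
    have hTv : volume T < ⊤ := hcs.isCompact.measure_lt_top
    set I : RN N → ENNReal := T.indicator 1 with hI
    have hIm : Measurable I := measurable_one.indicator hTm
    have hIint : ∫⁻ x, I x = volume T := by rw [hI, lintegral_indicator_one hTm]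
    have hle : ∀ x y, ENNReal.ofReal (|u x - u y| ^ p / ‖x - y‖ ^ ((N : ℝ) + s * p)) ≤
        I x * h (x - y) + I y * h (x - y) := by
      intro x y
      have hb : ENNReal.ofReal (|u x - u y| ^ p / ‖x - y‖ ^ ((N : ℝ) + s * p)) ≤ h (x - y) := by
        apply ENNReal.ofReal_le_ofReal
        have : |u x - u y| ≤ min (L * ‖x - y‖) C := le_min (hlip x y) (hbd x y)
        gcongr
      by_cases hx : x ∈ T
      · have : I x = 1 := by simp [hI, hx]
        rw [this, one_mul]
        exact hb.trans le_self_add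
      · by_cases hy : y ∈ T
        · have : I y = 1 := by simp [hI, hy]
          rw [this, one_mul]
          exact hb.trans le_add_self
        · rw [image_eq_zero_of_notMem_tsupport hx, image_eq_zero_of_notMem_tsupport hy]
          simp [hp0.ne']
    have m1 : Measurable (Function.uncurry fun x y : RN N => I x * h (x - y)) :=
      (hIm.comp measurable_fst).mul (hhm.comp (measurable_fst.sub measurable_snd))
    have m2 : Measurable (Function.uncurry fun x y : RN N => I y * h (x - y)) :=
      (hIm.comp measurable_snd).mul (hhm.comp (measurable_fst.sub measurable_snd))
    calc gagE N s p u ≤ ∫⁻ x, ∫⁻ y, (I x * h (x - y) + I y * h (x - y)) :=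
          lintegral_mono fun x => lintegral_mono fun y => hle x y
      _ = ∫⁻ x, ((∫⁻ y, I x * h (x - y)) + ∫⁻ y, I y * h (x - y)) := by
          apply lintegral_congr; intro x
          exact lintegral_add_left (m1.comp measurable_prodMk_left) _
      _ = (∫⁻ x, ∫⁻ y, I x * h (x - y)) + ∫⁻ x, ∫⁻ y, I y * h (x - y) := by
          exact lintegral_add_left m1.lintegral_prod_right _
      _ = (∫⁻ x, ∫⁻ y, I x * h (x - y)) + ∫⁻ y, ∫⁻ x, I y * h (x - y) := by
          rw [lintegral_lintegral_swap (f := fun x y => I y * h (x - y)) m2.aemeasurable]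
      _ = volume T * (∫⁻ z, h z) + volume T * ∫⁻ z, h z := by
          congr 1
          · rw [← hIint, ← lintegral_mul_const _ hIm]
            apply lintegral_congr; intro x
            have hm : Measurable fun y : RN N => h (x - y) :=
              hhm.comp (measurable_const.sub measurable_id)
            rw [lintegral_const_mul _ hm,
              lintegral_sub_left_eq_self]
          · rw [← hIint, ← lintegral_mul_const _ hIm]
            apply lintegral_congr; intro x
            have hm : Measurable fun y : RN N => h (y - x) :=
              hhm.comp (measurable_id.sub measurable_const)
            rw [lintegral_const_mul _ hm,
              lintegral_sub_right_eq_self]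
      _ < ⊤ := ENNReal.add_lt_top.2 ⟨ENNReal.mul_lt_top hTv hJ, ENNReal.mul_lt_top hTv hJ⟩

/-- the tent function -/
def tent (N : ℕ) (t l : ℝ) (x : RN N) : ℝ := t * max 0 (1 - l * ‖x‖)

lemma tent_cont (N : ℕ) (t l : ℝ) : Continuous (tent N t l) := by unfold tent; fun_prop

lemma tent_cs (N : ℕ) (t l : ℝ) (hl : 0 < l) : HasCompactSupport (tent N t l) := by
  apply HasCompactSupport.intro (isCompact_closedBall (0 : RN N) l⁻¹)
  intro x hx
  have : l⁻¹ < ‖x‖ := by simpa using hx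
  have h2 : 1 < l * ‖x‖ := by
    have := mul_lt_mul_of_pos_left this hl
    rwa [mul_inv_cancel₀ hl.ne'] at this
  unfold tent
  rw [max_eq_left (by linarith), mul_zero]

lemma tent_memW (N : ℕ) (s p t l : ℝ) (hN : 2 ≤ N) (hs : 0 < s) (hs1 : s < 1) (hp : 2 ≤ p)
    (ht : 0 < t) (hl : 0 < l) : memW N s p (tent N t l) := by
  refine memW_of_lip N s p (t * l) t hN hs hs1 hp (by positivity) ht.le _ (tent_cont N t l) ?_ ?_
    (tent_cs N t l hl)
  · intro x y
    unfold tent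
    rw [← mul_sub, abs_mul, abs_of_pos ht, mul_assoc]
    gcongr
    calc |max 0 (1 - l * ‖x‖) - max 0 (1 - l * ‖y‖)|
        ≤ max |(0:ℝ) - 0| |(1 - l * ‖x‖) - (1 - l * ‖y‖)| := abs_max_sub_max_le_max _ _ _ _
      _ = l * |‖y‖ - ‖x‖| := by
        rw [sub_self, abs_zero, max_eq_right (abs_nonneg _)]
        rw [← abs_of_pos hl, ← abs_mul, abs_of_pos hl]; congr 1; ring
      _ ≤ l * ‖x - y‖ := by
        gcongr
        rw [abs_sub_comm]
        exact abs_norm_sub_norm_le x y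
  · intro x y
    have h1 : ∀ z : RN N, 0 ≤ tent N t l z ∧ tent N t l z ≤ t := by
      intro z
      unfold tent
      have : max 0 (1 - l * ‖z‖) ≤ 1 := max_le zero_le_one (by
        have : 0 ≤ l * ‖z‖ := by positivity
        linarith)
      exact ⟨by positivity, by nlinarith⟩
    have hx := h1 x
    have hy := h1 y
    rw [abs_le]; constructor <;> linarith

lemma primF_cont (f : ℝ → ℝ) (hf : Continuous f) : Continuous (primF f) := by
  unfold primF
  exact intervalIntegral.continuous_primitive (fun a b => hf.intervalIntegrable a b) 0

lemma primF_lower (f : ℝ → ℝ) (hf : Continuous f) (q μ : ℝ) (hq : 1 < q)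
    (h : ∀ t ≥ (0:ℝ), μ * t ^ (q - 1) ≤ f t) (t : ℝ) (ht : 0 ≤ t) :
    μ * t ^ q / q ≤ primF f t := by
  have h1 : ∫ τ in (0:ℝ)..t, μ * τ ^ (q - 1) = μ * t ^ q / q := by
    rw [intervalIntegral.integral_const_mul, integral_rpow (Or.inl (by linarith)),
      Real.zero_rpow (by linarith)]
    simp only [sub_add_cancel, sub_zero]; ring
  rw [← h1, primF]
  apply intervalIntegral.integral_mono_on ht
  · exact ((intervalIntegral.intervalIntegrable_rpow' (by linarith)).const_mul _)
  · exact hf.intervalIntegrable _ _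
  · intro x hx; exact h x hx.1

lemma Gfun_cont (p : ℝ) (hp : 0 < p) (f : ℝ → ℝ) (hf : Continuous f) : Continuous (Gfun p f) := by
  unfold Gfun
  exact (primF_cont f hf).sub ((continuous_abs.rpow_const fun x => Or.inr hp.le).div_const _)

lemma Gfun_zero (p : ℝ) (hp : 0 < p) (f : ℝ → ℝ) : Gfun p f 0 = 0 := by
  simp [Gfun, primF, hp.ne']

lemma Gtent_integrable (N : ℕ) (p t : ℝ) (f : ℝ → ℝ) (hp0 : 0 < p) (hf : Continuous f) :
    Integrable (fun x : RN N => Gfun p f (tent N t 1 x)) volume := by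
  have h1 : Continuous (fun x : RN N => Gfun p f (tent N t 1 x)) :=
    (Gfun_cont p hp0 f hf).comp (tent_cont N t 1)
  have h2 : HasCompactSupport (fun x : RN N => Gfun p f (tent N t 1 x)) :=
    (tent_cs N t 1 one_pos).comp_left (g := Gfun p f) (Gfun_zero p hp0 f)
  exact h1.integrable_of_hasCompactSupport h2

lemma exists_pos_int (N : ℕ) (p q μ : ℝ) (f : ℝ → ℝ) (hp : 2 ≤ p) (hf : Continuous f)
    (hq : p < q) (hμ : 0 < μ)
    (h : ∀ t ≥ (0:ℝ), μ * t ^ (q - 1) ≤ f t) :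
    ∃ t > (0:ℝ), 0 < ∫ x : RN N, Gfun p f (tent N t 1 x) := by
  have hp0 : 0 < p := by linarith
  have hq0 : 0 < q := by linarith
  have hc := tent_cont N 1 1
  have hcs := tent_cs N 1 1 one_pos
  have h0 : ∀ x, 0 ≤ tent N 1 1 x := fun x => by unfold tent; positivity
  have hint : ∀ r : ℝ, 0 < r → Integrable (fun x => tent N 1 1 x ^ r) volume := by
    intro r hr
    apply Continuous.integrable_of_hasCompactSupport
    · exact hc.rpow_const fun x => Or.inr hr.le
    · exact hcs.comp_left (g := fun t : ℝ => t ^ r) (by simp [hr.ne'])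
  set a := ∫ x, tent N 1 1 x ^ q with ha
  set b := ∫ x, tent N 1 1 x ^ p with hb
  have ha0 : 0 < a := by
    apply Continuous.integral_pos_of_hasCompactSupport_nonneg_nonzero (x := 0)
    · exact hc.rpow_const fun x => Or.inr hq0.le
    · exact hcs.comp_left (g := fun t : ℝ => t ^ q) (by simp [hq0.ne'])
    · intro x; exact Real.rpow_nonneg (h0 x) q
    · simp [tent]
  have hb0 : 0 ≤ b := integral_nonneg fun x => Real.rpow_nonneg (h0 x) p
  set Q := (b / p + 1) * q / (μ * a) with hQ
  have hQ0 : 0 < Q := by positivity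
  have hqp : 0 < q - p := by linarith
  set t := Q ^ (q - p)⁻¹ with ht
  have ht0 : 0 < t := by positivity
  have htq : t ^ q = t ^ p * Q := by
    have : Q = t ^ (q - p) := by
      rw [ht, Real.rpow_inv_rpow hQ0.le hqp.ne']
    rw [this, ← Real.rpow_add ht0]; congr 1; ring
  refine ⟨t, ht0, ?_⟩
  have hlow : ∫ x, (μ / q * t ^ q * tent N 1 1 x ^ q - t ^ p / p * tent N 1 1 x ^ p) ≤
      ∫ x : RN N, Gfun p f (tent N t 1 x) := by
    apply integral_mono
    · exact ((hint q hq0).const_mul _).sub ((hint p hp0).const_mul _)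
    · exact Gtent_integrable N p t f hp0 hf
    · intro x
      have e : tent N t 1 x = t * tent N 1 1 x := by simp [tent]
      have h1 := primF_lower f hf q μ (by linarith) h (t * tent N 1 1 x)
        (mul_nonneg ht0.le (h0 x))
      simp only [Gfun, e]
      rw [abs_of_nonneg (mul_nonneg ht0.le (h0 x))]
      rw [Real.mul_rpow ht0.le (h0 x)] at h1 ⊢
      calc _ = μ * (t ^ q * tent N 1 1 x ^ q) / q - t ^ p * tent N 1 1 x ^ p / p := by ring
        _ ≤ _ := by linarith
  rw [integral_sub ((hint q hq0).const_mul _) ((hint p hp0).const_mul _),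
    integral_const_mul, integral_const_mul, ← ha, ← hb] at hlow
  refine lt_of_lt_of_le ?_ hlow
  have : μ / q * t ^ q * a - t ^ p / p * b = t ^ p := by
    rw [htq, hQ]; field_simp; ring
  rw [this]; positivity

lemma Mset_nonempty (N : ℕ) (s p q μ : ℝ) (f : ℝ → ℝ) (hN : 2 ≤ N) (hs : 0 < s) (hs1 : s < 1)
    (hp : 2 ≤ p) (hf : Continuous f)
    (hq : p < q) (hμ : 0 < μ)
    (h : ∀ t ≥ (0:ℝ), μ * t ^ (q - 1) ≤ f t) : (Mset N s p f).Nonempty := by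
  obtain ⟨t, ht, hI⟩ := exists_pos_int N p q μ f hp hf hq hμ h
  set I := ∫ x : RN N, Gfun p f (tent N t 1 x) with hIdef
  set l := I ^ (N : ℝ)⁻¹ with hl
  have hl0 : 0 < l := by positivity
  refine ⟨tent N t l, tent_memW N s p t l hN hs hs1 hp ht hl0, ?_, ?_⟩
  · intro hz
    have := congrFun hz 0
    simp [tent, ht.ne'] at this
  · have e : ∀ x, tent N t l x = tent N t 1 (l • x) := by
      intro x; simp [tent, norm_smul, abs_of_pos hl0]
    simp only [e]
    rw [Measure.integral_comp_smul volume (fun x => Gfun p f (tent N t 1 x)) l,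
      finrank_euclideanSpace_fin, ← hIdef, hl, Real.rpow_inv_natCast_pow hI.le (by omega),
      abs_of_pos (by positivity), smul_eq_mul, inv_mul_cancel₀ hI.ne']

lemma muStarSub_nonneg (N : ℕ) (s p q : ℝ) (hs : 0 < s) (hp : 2 ≤ p) (hq : p < q)
    (hsp : s * p < N) : 0 ≤ muStarSub N s p q := by
  have hS : 0 ≤ Sconst N s p := by
    apply Real.sInf_nonneg
    rintro r ⟨u, -, -, -, -, rfl⟩
    have : 0 ≤ gagP N s p u := ENNReal.toReal_nonneg
    have h2 : 0 ≤ ∫ x : RN N, |u x| ^ (p * N / ((N : ℝ) - s * p)) :=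
      integral_nonneg fun x => by positivity
    positivity
  have hCq : 0 ≤ CqConst N s p q := by
    apply Real.sInf_nonneg
    rintro r ⟨u, -, -, rfl⟩
    have : 0 ≤ gagP N s p u := ENNReal.toReal_nonneg
    have h2 : 0 ≤ ∫ x : RN N, |u x| ^ q := integral_nonneg fun x => by positivity
    have h3 : 0 ≤ ∫ x : RN N, |u x| ^ p := integral_nonneg fun x => by positivity
    unfold sobNormP
    positivity
  have h1 : 0 ≤ (N : ℝ) - s * p := by linarith
  have h2 : 0 ≤ q - p := by linarith
  have h3 : 0 ≤ p := by linarith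
  have h4 : 0 ≤ q := by linarith
  unfold muStarSub
  positivity

lemma Gfun_upper (N : ℕ) (s p q : ℝ) (f : ℝ → ℝ) (hp : 2 ≤ p) (hfc : Continuous f)
    (hq : q = p * N / ((N : ℝ) - s * p)) (hpq : p < q)
    (hf0 : ∀ t ≤ (0:ℝ), f t = 0)
    (hf1 : hypF1 p f) (hf2 : hypF2 N s p f) (hf5 : hypF5 p f) :
    ∃ C > (0:ℝ), ∀ t, Gfun p f t ≤ C * |t| ^ q := by
  have hp0 : 0 < p := by linarith
  have hsm : ∃ δ > (0:ℝ), ∀ t, 0 < t → t < δ → f t ≤ t ^ (p - 1) := by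
    have h1 : ∀ᶠ t in 𝓝[≠] (0:ℝ), f t / (|t| ^ (p - 2) * t) < 1 := hf1.eventually_lt_const one_pos
    have h2 : ∀ᶠ t in 𝓝[>] (0:ℝ), f t / (|t| ^ (p - 2) * t) < 1 :=
      h1.filter_mono (nhdsWithin_mono _ fun x hx => (ne_of_gt hx))
    obtain ⟨δ, hδ, h3⟩ := mem_nhdsGT_iff_exists_Ioo_subset.1 h2
    refine ⟨δ, hδ, fun t ht htδ => ?_⟩
    have h4 : f t / (|t| ^ (p - 2) * t) < 1 := h3 ⟨ht, htδ⟩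
    rw [abs_of_pos ht, div_lt_one (by positivity)] at h4
    have : t ^ (p - 1) = t ^ (p - 2) * t := by
      rw [← Real.rpow_add_one ht.ne']; congr 1; ring
    rw [this]; exact h4.le
  have hlg : ∃ R > (0:ℝ), ∀ t, R ≤ t → f t ≤ 2 * t ^ (q - 1) := by
    have h1 : ∀ᶠ t in atTop,
        ((f t / t ^ (p * N / ((N : ℝ) - s * p) - 1) : ℝ) : EReal) < ((2:ℝ) : EReal) := by
      refine eventually_lt_of_limsup_lt (lt_of_le_of_lt hf2 ?_)
      exact_mod_cast (one_lt_two : (1:ℝ) < 2)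
    obtain ⟨R, hR⟩ := eventually_atTop.1 h1
    refine ⟨max R 1, by positivity, fun t ht => ?_⟩
    have ht0 : 0 < t := lt_of_lt_of_le one_pos ((le_max_right _ _).trans ht)
    have h2 := EReal.coe_lt_coe_iff.1 (hR t ((le_max_left _ _).trans ht))
    rw [← hq, div_lt_iff₀ (by positivity)] at h2
    exact h2.le
  obtain ⟨δ, hδ, hsm⟩ := hsm
  obtain ⟨R, hR, hlg⟩ := hlg
  obtain ⟨C0, hC0⟩ := (isCompact_Icc (a := δ) (b := R)).exists_bound_of_continuousOn hfc.continuousOn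
  set C := max 2 (C0 / δ ^ (q - 1)) with hC
  have hCpos : 0 < C := lt_of_lt_of_le two_pos (le_max_left _ _)
  have hall : ∀ t, 0 < t → f t ≤ t ^ (p - 1) + C * t ^ (q - 1) := by
    intro t ht
    have hA : 0 ≤ t ^ (p - 1) := by positivity
    have hB : 0 ≤ C * t ^ (q - 1) := by positivity
    rcases lt_or_ge t δ with h | h
    · linarith [hsm t ht h]
    rcases le_or_gt R t with h' | h'
    · have := hlg t h'
      have : 2 * t ^ (q - 1) ≤ C * t ^ (q - 1) := by gcongr; exact le_max_left _ _
      linarith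
    · have h1 := hC0 t ⟨h, h'.le⟩
      have h2 : f t ≤ C0 := (le_abs_self _).trans h1
      have h3 : 0 ≤ C0 := (norm_nonneg _).trans h1
      have h4 : C0 ≤ C * t ^ (q - 1) := by
        calc C0 = C0 / δ ^ (q - 1) * δ ^ (q - 1) := by field_simp
          _ ≤ C * t ^ (q - 1) := by
            have : δ ^ (q - 1) ≤ t ^ (q - 1) := Real.rpow_le_rpow hδ.le h (by linarith)
            gcongr
            exact le_max_right _ _
      linarith
  refine ⟨C / p, by positivity, fun t => ?_⟩
  rcases le_or_gt t 0 with ht | ht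
  · have : primF f t = 0 := by
      unfold primF
      rw [intervalIntegral.integral_congr (g := fun _ => 0), intervalIntegral.integral_zero]
      intro x hx
      rw [uIcc_of_ge ht] at hx
      exact hf0 x hx.2
    unfold Gfun
    rw [this]
    have h1 : 0 ≤ |t| ^ p / p := by positivity
    have h2 : 0 ≤ C / p * |t| ^ q := by positivity
    linarith
  · have h1 := hf5.1 t ht
    have h2 := mul_le_mul_of_nonneg_right (hall t ht) ht.le
    have e1 : t ^ p = t ^ (p - 1) * t := by
      rw [← Real.rpow_add_one ht.ne']; congr 1; ring
    have e2 : t ^ q = t ^ (q - 1) * t := by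
      rw [← Real.rpow_add_one ht.ne']; congr 1; ring
    unfold Gfun
    rw [abs_of_pos ht]
    have h3 : p * primF f t ≤ t ^ p + C * t ^ q := by
      rw [e1, e2]; linarith
    have h4 : primF f t ≤ (t ^ p + C * t ^ q) / p := by
      rw [le_div_iff₀ hp0]; linarith
    calc _ ≤ (t ^ p + C * t ^ q) / p - t ^ p / p := by linarith
      _ = _ := by ring

theorem D_positive (N : ℕ) (s p : ℝ) (f : ℝ → ℝ)
    (hN : 2 ≤ N) (hs : s ∈ Set.Ioo (0:ℝ) 1) (hp : 2 ≤ p)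
    (hsp : s * p < N)
    (hfc : Continuous f) (hf0 : ∀ t ≤ (0:ℝ), f t = 0)
    (hf1 : hypF1 p f) (hf2 : hypF2 N s p f)
    (hf3gs : ∃ q μ : ℝ, p < q ∧ q < p * N / ((N : ℝ) - s * p) ∧
      muStarSub N s p q < μ ∧ ∀ t ≥ (0:ℝ), μ * t ^ (q - 1) ≤ f t)
    (hf5 : hypF5 p f) :
    0 < Dconst N s p f := by
  obtain ⟨hs0, hs1⟩ := hs
  obtain ⟨q', μ, hpq', hq'q, hμ, hlow⟩ := hf3gs
  have hp0 : 0 < p := by linarith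
  have hμ0 : 0 < μ := lt_of_le_of_lt (muStarSub_nonneg N s p q' hs0 hp hpq' hsp) hμ
  have hNpos : (0:ℝ) < N := by positivity
  have hd : 0 < (N : ℝ) - s * p := by linarith
  obtain ⟨q, hq⟩ : ∃ q, q = p * N / ((N : ℝ) - s * p) := ⟨_, rfl⟩
  rw [← hq] at hq'q
  have hpq : p < q := hpq'.trans hq'q
  have hrel : p + q * (s * p / N) = q := by
    have h : q * ((N : ℝ) - s * p) = p * N := by rw [hq, div_mul_cancel₀ _ hd.ne']
    have h2 : p + q * (s * p / N) = (p * N + q * (s * p)) / N := by field_simp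
    rw [h2, div_eq_iff hNpos.ne', ← h]
    ring
  have hα : 0 < 1 - s * p / N := by
    have : s * p / N < 1 := by rw [div_lt_one hNpos]; exact hsp
    linarith
  obtain ⟨K, hK, hsob⟩ := sobolev_ineq N s p q hN hs0 hp0 hpq hsp hrel
  obtain ⟨C, hC, hG⟩ := Gfun_upper N s p q f hp hfc hq hpq hf0 hf1 hf2 hf5
  have hne := Mset_nonempty N s p q' μ f hN hs0 hs1 hp hfc hpq' hμ0 hlow
  have hpos : 0 < 1 / p * ((1 / C) ^ (1 - s * p / N) / K) := by positivity
  refine lt_of_lt_of_le hpos (le_csInf ?_ ?_)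
  · obtain ⟨u, hu⟩ := hne
    exact ⟨_, u, hu, rfl⟩
  · rintro c ⟨u, ⟨huW, -, hu1⟩, rfl⟩
    obtain ⟨hint, hineq⟩ := hsob u huW
    have hGi : Integrable (fun x => Gfun p f (u x)) volume := by
      by_contra hcon
      rw [integral_undef hcon] at hu1
      exact zero_ne_one hu1
    have h1 : 1 ≤ C * ∫ x, |u x| ^ q := by
      rw [← hu1, ← integral_const_mul]
      exact integral_mono hGi (hint.const_mul _) fun x => hG (u x)
    have h2 : 1 / C ≤ ∫ x, |u x| ^ q := by
      rw [div_le_iff₀ hC]; linarith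
    have h3 : (1 / C) ^ (1 - s * p / N) ≤ K * gagP N s p u :=
      (Real.rpow_le_rpow (by positivity) h2 hα.le).trans hineq
    have h4 : (1 / C) ^ (1 - s * p / N) / K ≤ gagP N s p u := by
      rw [div_le_iff₀ hK]; linarith
    gcongr
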